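/- Let H be a commutative Hopf algebra with bijective antipode over a commutative ring k (faithfully flat over k), and let M, N be left-right Yetter-Drinfeld modules over H with M finitely generated and projective as a left H-module. Then Hom_H(M, N) is a right H-comodule with coaction determined by f_0(m) ⊗ f_1 = f(m_0)_0 ⊗ f(m_0)_1 S(m_1) for all m in M, and its coinvariants are exactly the H-colinear maps: Hom_H^H(M, N) = Hom_H(M, N)^{coH}. -/

import Mathlib

/-!
Common definitions for formalizing "Semisimplicity of the categories of
Yetter-Drinfeld modules and Long dimodules" (Caenepeel, Guédénon).
-/

open TensorProduct

noncomputable section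
namespace YDPaper

section RingPart

variable (k H : Type) [CommRing k] [Ring H] [HopfAlgebra k H]

/-- `ρ : M →ₗ[k] M ⊗[k] H` is a (coassociative, counital) right `H`-comodule
structure on `M`. -/
def IsComod {M : Type} [AddCommGroup M] [Module k M] (ρ : M →ₗ[k] M ⊗[k] H) : Prop :=
  (∀ m : M, (TensorProduct.rid k M)
      ((LinearMap.lTensor M (Coalgebra.counit (R := k) (A := H))) (ρ m)) = m) ∧
  (∀ m : M, (TensorProduct.assoc k M H H) ((LinearMap.rTensor H ρ) (ρ m)) =
      (LinearMap.lTensor M (Coalgebra.comul (R := k) (A := H))) (ρ m))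

/-- The iterated comultiplication `h ↦ (h₁ ⊗ h₂) ⊗ h₃`. -/
def Delta2 : H →ₗ[k] (H ⊗[k] H) ⊗[k] H :=
  (LinearMap.rTensor H (Coalgebra.comul (R := k) (A := H))).comp
    (Coalgebra.comul (R := k) (A := H))

/-- The Yetter-Drinfeld compatibility condition
`ρ(h • m) = h₂ • m₀ ⊗ h₃ m₁ S⁻¹(h₁)`, expressed via arbitrary Sweedler
decompositions of `Δ²(h)` and `ρ(m)` into finite sums of pure tensors. -/
def IsYDCompat (Sinv : H →ₗ[k] H) {M : Type} [AddCommGroup M] [Module k M] [Module H M]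
    (ρ : M →ₗ[k] M ⊗[k] H) : Prop :=
  ∀ (h : H) (m : M) (s t : Finset ℕ) (a b c : ℕ → H) (m₀ : ℕ → M) (m₁ : ℕ → H),
    (∑ i ∈ s, (a i ⊗ₜ[k] b i) ⊗ₜ[k] c i) = Delta2 k H h →
    (∑ j ∈ t, m₀ j ⊗ₜ[k] m₁ j) = ρ m →
    ρ (h • m) = ∑ i ∈ s, ∑ j ∈ t, (b i • m₀ j) ⊗ₜ[k] (c i * m₁ j * Sinv (a i))

/-- The `k`-linear map `m ↦ h • m`. -/
def smulMap {M : Type} [AddCommGroup M] [Module k M] [Module H M] [SMulCommClass H k M]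
    (h : H) : M →ₗ[k] M where
  toFun m := h • m
  map_add' := smul_add h
  map_smul' c m := (smul_comm h c m)

/-- The Long dimodule compatibility condition `ρ(h • m) = h • m₀ ⊗ m₁`. -/
def IsLongCompat {M : Type} [AddCommGroup M] [Module k M] [Module H M] [SMulCommClass H k M]
    (ρ : M →ₗ[k] M ⊗[k] H) : Prop :=
  ∀ (h : H) (m : M), ρ (h • m) = (LinearMap.rTensor H (smulMap k H h)) (ρ m)

/-- Morphisms in the categories of Yetter-Drinfeld modules and of Long dimodules:
`H`-linear and `H`-colinear maps. -/
def IsHom {A B : Type} [AddCommGroup A] [Module k A] [Module H A]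
    [AddCommGroup B] [Module k B] [Module H B]
    (ρA : A →ₗ[k] A ⊗[k] H) (ρB : B →ₗ[k] B ⊗[k] H) (f : A →ₗ[k] B) : Prop :=
  (∀ (h : H) (a : A), f (h • a) = h • f a) ∧
  ρB.comp f = (LinearMap.rTensor H f).comp ρA

/-- `H`-colinearity of a `k`-linear map between right `H`-comodules. -/
def IsColin {A B : Type} [AddCommGroup A] [Module k A]
    [AddCommGroup B] [Module k B]
    (ρA : A →ₗ[k] A ⊗[k] H) (ρB : B →ₗ[k] B ⊗[k] H) (f : A →ₗ[k] B) : Prop :=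
  ρB.comp f = (LinearMap.rTensor H f).comp ρA

/-- A bundled left-right Yetter-Drinfeld module over `H` (with chosen inverse `Sinv`
of the antipode). -/
structure YDCat (Sinv : H →ₗ[k] H) where
  M : Type
  [iAdd : AddCommGroup M]
  [iModk : Module k M]
  [iModH : Module H M]
  [iTower : IsScalarTower k H M]
  [iComm : SMulCommClass H k M]
  ρ : M →ₗ[k] M ⊗[k] H
  comod : IsComod k H ρ
  compat : IsYDCompat k H Sinv ρ

attribute [instance] YDCat.iAdd YDCat.iModk YDCat.iModH YDCat.iTower YDCat.iComm

/-- A bundled left-right Long dimodule over `H`. -/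
structure LongCat where
  M : Type
  [iAdd : AddCommGroup M]
  [iModk : Module k M]
  [iModH : Module H M]
  [iTower : IsScalarTower k H M]
  [iComm : SMulCommClass H k M]
  ρ : M →ₗ[k] M ⊗[k] H
  comod : IsComod k H ρ
  compat : IsLongCompat k H ρ

attribute [instance] LongCat.iAdd LongCat.iModk LongCat.iModH LongCat.iTower LongCat.iComm

/-- A bundled right `H`-comodule. -/
structure ComodCat where
  V : Type
  [iAdd : AddCommGroup V]
  [iModk : Module k V]
  ρ : V →ₗ[k] V ⊗[k] H
  comod : IsComod k H ρ

attribute [instance] ComodCat.iAdd ComodCat.iModk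

section Subobjects

variable {k H}
variable {M : Type} [AddCommGroup M] [Module k M] [Module H M] [IsScalarTower k H M]

/-- A subobject in the category of Yetter-Drinfeld modules (or Long dimodules):
an `H`-submodule which is stable under the coaction, i.e. `ρ(p) ⊆ p ⊗ H`. -/
def IsSubobject (ρ : M →ₗ[k] M ⊗[k] H) (p : Submodule H M) : Prop :=
  ∀ m ∈ p, ρ m ∈ LinearMap.range (LinearMap.rTensor H (p.restrictScalars k).subtype)

/-- A simple subobject: a nonzero coaction-stable `H`-submodule with no proper
nonzero coaction-stable `H`-submodules. -/
def IsSimpleSubobject (ρ : M →ₗ[k] M ⊗[k] H) (p : Submodule H M) : Prop :=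
  IsSubobject ρ p ∧ p ≠ ⊥ ∧
    ∀ q : Submodule H M, IsSubobject ρ q → q ≤ p → q = ⊥ ∨ q = p

/-- `M` is the (internal) direct sum of a family of simple subobjects which are
finitely generated as `H`-modules. -/
def IsSemisimpleObj (ρ : M →ₗ[k] M ⊗[k] H) : Prop :=
  ∃ (ι : Type) (S : ι → Submodule H M),
    (∀ i, IsSimpleSubobject ρ (S i) ∧ (S i).FG) ∧
    iSupIndep S ∧ (⨆ i, S i) = ⊤

end Subobjects

section Subcomodules

variable {k H}
variable {V : Type} [AddCommGroup V] [Module k V]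

/-- A subcomodule: a `k`-submodule stable under the coaction. -/
def IsSubcomod (ρ : V →ₗ[k] V ⊗[k] H) (p : Submodule k V) : Prop :=
  ∀ v ∈ p, ρ v ∈ LinearMap.range (LinearMap.rTensor H p.subtype)

/-- A simple subcomodule. -/
def IsSimpleSubcomod (ρ : V →ₗ[k] V ⊗[k] H) (p : Submodule k V) : Prop :=
  IsSubcomod ρ p ∧ p ≠ ⊥ ∧
    ∀ q : Submodule k V, IsSubcomod ρ q → q ≤ p → q = ⊥ ∨ q = p

/-- A comodule is semisimple if it is the internal direct sum of a family of simple
subcomodules. -/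
def IsSemisimpleComod (ρ : V →ₗ[k] V ⊗[k] H) : Prop :=
  ∃ (ι : Type) (S : ι → Submodule k V),
    (∀ i, IsSimpleSubcomod ρ (S i)) ∧ iSupIndep S ∧ (⨆ i, S i) = ⊤

end Subcomodules

/-- `H` is cosemisimple: every right `H`-comodule is a direct sum of simple
subcomodules. -/
def Cosemisimple : Prop := ∀ C : ComodCat k H, IsSemisimpleComod C.ρ

section Coinv

variable {k H}
variable {A B : Type} [AddCommGroup A] [Module k A] [AddCommGroup B] [Module k B]

/-- The coinvariants `M^{co H} = { m | ρ m = m ⊗ 1 }` of a right `H`-comodule. -/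
def coinv (ρ : A →ₗ[k] A ⊗[k] H) : Submodule k A :=
  LinearMap.ker (ρ - (TensorProduct.mk k A H).flip 1)

lemma mem_coinv {ρ : A →ₗ[k] A ⊗[k] H} {a : A} :
    a ∈ coinv ρ ↔ ρ a = a ⊗ₜ[k] (1 : H) := by
  simp [coinv, LinearMap.mem_ker, sub_eq_zero]

/-- The map induced on coinvariants by an `H`-colinear map. -/
def coinvMap {ρA : A →ₗ[k] A ⊗[k] H} {ρB : B →ₗ[k] B ⊗[k] H} (f : A →ₗ[k] B)
    (hf : IsColin k H ρA ρB f) : ↥(coinv ρA) →ₗ[k] ↥(coinv ρB) :=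
  f.restrict (fun a ha => by
    have h1 : ρA a = a ⊗ₜ[k] (1 : H) := mem_coinv.1 ha
    have h2 : ρB (f a) = (LinearMap.rTensor H f) (ρA a) := by
      have := congrArg (fun (g : A →ₗ[k] B ⊗[k] H) => g a) hf
      simpa using this
    rw [mem_coinv, h2, h1, LinearMap.rTensor_tmul])

end Coinv

/-- Exactness of the coinvariants functor on the category of Yetter-Drinfeld
modules. -/
def CoinvExactYD (Sinv : H →ₗ[k] H) : Prop :=
  ∀ (A B C : YDCat k H Sinv) (f : A.M →ₗ[k] B.M) (g : B.M →ₗ[k] C.M)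
    (hf : IsHom k H A.ρ B.ρ f) (hg : IsHom k H B.ρ C.ρ g),
    Function.Injective f → Function.Surjective g →
    LinearMap.range f = LinearMap.ker g →
    Function.Injective (coinvMap f hf.2) ∧
    LinearMap.range (coinvMap f hf.2) = LinearMap.ker (coinvMap g hg.2) ∧
    Function.Surjective (coinvMap g hg.2)

/-- Exactness of the coinvariants functor on the category of right `H`-comodules. -/
def CoinvExactComod : Prop :=
  ∀ (A B C : ComodCat k H) (f : A.V →ₗ[k] B.V) (g : B.V →ₗ[k] C.V)
    (hf : IsColin k H A.ρ B.ρ f) (hg : IsColin k H B.ρ C.ρ g),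
    Function.Injective f → Function.Surjective g →
    LinearMap.range f = LinearMap.ker g →
    Function.Injective (coinvMap f hf) ∧
    LinearMap.range (coinvMap f hf) = LinearMap.ker (coinvMap g hg) ∧
    Function.Surjective (coinvMap g hg)

section Eval

variable {k H}
variable {M N : Type} [AddCommGroup M] [Module k M] [Module H M]
  [IsScalarTower k H M] [SMulCommClass H k M]
  [AddCommGroup N] [Module k N] [Module H N] [IsScalarTower k H N] [SMulCommClass H k N]

/-- Evaluation at `m` of `H`-linear maps, as a `k`-linear map. -/
def evalAtH (m : M) : (M →ₗ[H] N) →ₗ[k] N where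
  toFun f := f m
  map_add' _ _ := rfl
  map_smul' _ _ := rfl

/-- Evaluation at `m` of `k`-linear maps, as a `k`-linear map. -/
def evalAtK {V : Type} [AddCommGroup V] [Module k V] (v : V) :
    (V →ₗ[k] N) →ₗ[k] N where
  toFun f := f v
  map_add' _ _ := rfl
  map_smul' _ _ := rfl

/-- Contraction `N ⊗ H → N` along a functional `φ : H → k`. -/
def contract (φ : H →ₗ[k] k) : N ⊗[k] H →ₗ[k] N :=
  (TensorProduct.rid k N).toLinearMap.comp (LinearMap.lTensor N φ)

/-- Post-composition with an `H`-linear map, as a `k`-linear map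
`Hom_H(X, M) → Hom_H(X, N)`; here `X` is the (implicit) source. -/
def postcompH {X : Type} [AddCommGroup X] [Module k X] [Module H X]
    [IsScalarTower k H X] [SMulCommClass H k X]
    (f : M →ₗ[k] N) (hf : ∀ (h : H) (m : M), f (h • m) = h • f m) :
    (X →ₗ[H] M) →ₗ[k] (X →ₗ[H] N) where
  toFun φ :=
    { toFun := fun x => f (φ x)
      map_add' := fun x y => by simp
      map_smul' := fun h x => by simp [hf] }
  map_add' φ ψ := by ext x; simp
  map_smul' c φ := by ext x; simp

end Eval

/-- Condition (†) for the category of Yetter-Drinfeld modules: for every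
Yetter-Drinfeld module `X` which is finitely generated as a left `H`-module,
the functor `Hom_H(X, -)` is exact on the category of Yetter-Drinfeld modules. -/
def DaggerYD (Sinv : H →ₗ[k] H) : Prop :=
  ∀ X : YDCat k H Sinv, Module.Finite H X.M →
  ∀ (A B C : YDCat k H Sinv) (f : A.M →ₗ[k] B.M) (g : B.M →ₗ[k] C.M)
    (hf : IsHom k H A.ρ B.ρ f) (hg : IsHom k H B.ρ C.ρ g),
    Function.Injective f → Function.Surjective g →
    LinearMap.range f = LinearMap.ker g →
    Function.Injective (postcompH (X := X.M) f hf.1) ∧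
    LinearMap.range (postcompH (X := X.M) f hf.1) =
      LinearMap.ker (postcompH (X := X.M) g hg.1) ∧
    Function.Surjective (postcompH (X := X.M) g hg.1)

/-- Condition (†) for the category of Long dimodules. -/
def DaggerLong : Prop :=
  ∀ X : LongCat k H, Module.Finite H X.M →
  ∀ (A B C : LongCat k H) (f : A.M →ₗ[k] B.M) (g : B.M →ₗ[k] C.M)
    (hf : IsHom k H A.ρ B.ρ f) (hg : IsHom k H B.ρ C.ρ g),
    Function.Injective f → Function.Surjective g →
    LinearMap.range f = LinearMap.ker g →
    Function.Injective (postcompH (X := X.M) f hf.1) ∧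
    LinearMap.range (postcompH (X := X.M) f hf.1) =
      LinearMap.ker (postcompH (X := X.M) g hg.1) ∧
    Function.Surjective (postcompH (X := X.M) g hg.1)

/-- Projective object in the category of Yetter-Drinfeld modules. -/
def IsProjectiveYD (Sinv : H →ₗ[k] H) (P : YDCat k H Sinv) : Prop :=
  ∀ (A B : YDCat k H Sinv) (g : A.M →ₗ[k] B.M) (f : P.M →ₗ[k] B.M),
    IsHom k H A.ρ B.ρ g → Function.Surjective g → IsHom k H P.ρ B.ρ f →
    ∃ l : P.M →ₗ[k] A.M, IsHom k H P.ρ A.ρ l ∧ g.comp l = f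

/-- Projective object in the category of Long dimodules. -/
def IsProjectiveLong (P : LongCat k H) : Prop :=
  ∀ (A B : LongCat k H) (g : A.M →ₗ[k] B.M) (f : P.M →ₗ[k] B.M),
    IsHom k H A.ρ B.ρ g → Function.Surjective g → IsHom k H P.ρ B.ρ f →
    ∃ l : P.M →ₗ[k] A.M, IsHom k H P.ρ A.ρ l ∧ g.comp l = f

/-- Injective object in the category of Yetter-Drinfeld modules. -/
def IsInjectiveYD (Sinv : H →ₗ[k] H) (I : YDCat k H Sinv) : Prop :=
  ∀ (A B : YDCat k H Sinv) (ι : A.M →ₗ[k] B.M) (f : A.M →ₗ[k] I.M),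
    IsHom k H A.ρ B.ρ ι → Function.Injective ι → IsHom k H A.ρ I.ρ f →
    ∃ g : B.M →ₗ[k] I.M, IsHom k H B.ρ I.ρ g ∧ g.comp ι = f

/-- Projective object in the category of right `H`-comodules. -/
def IsProjectiveComod (P : ComodCat k H) : Prop :=
  ∀ (A B : ComodCat k H) (g : A.V →ₗ[k] B.V) (f : P.V →ₗ[k] B.V),
    IsColin k H A.ρ B.ρ g → Function.Surjective g → IsColin k H P.ρ B.ρ f →
    ∃ l : P.V →ₗ[k] A.V, IsColin k H P.ρ A.ρ l ∧ g.comp l = f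

section HomLemmas

variable {k H}
variable {A B C : Type} [AddCommGroup A] [Module k A] [Module H A]
  [AddCommGroup B] [Module k B] [Module H B]
  [AddCommGroup C] [Module k C] [Module H C]

lemma IsHom.comp' {ρA : A →ₗ[k] A ⊗[k] H} {ρB : B →ₗ[k] B ⊗[k] H} {ρC : C →ₗ[k] C ⊗[k] H}
    {f : A →ₗ[k] B} {g : B →ₗ[k] C}
    (hf : IsHom k H ρA ρB f) (hg : IsHom k H ρB ρC g) :
    IsHom k H ρA ρC (g.comp f) := by
  refine ⟨fun h a => by simp [LinearMap.comp_apply, hf.1, hg.1], ?_⟩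
  calc ρC.comp (g.comp f) = (ρC.comp g).comp f := by rw [LinearMap.comp_assoc]
    _ = ((LinearMap.rTensor H g).comp ρB).comp f := by rw [hg.2]
    _ = (LinearMap.rTensor H g).comp (ρB.comp f) := by rw [LinearMap.comp_assoc]
    _ = (LinearMap.rTensor H g).comp ((LinearMap.rTensor H f).comp ρA) := by rw [hf.2]
    _ = ((LinearMap.rTensor H g).comp (LinearMap.rTensor H f)).comp ρA := by
          rw [LinearMap.comp_assoc]
    _ = (LinearMap.rTensor H (g.comp f)).comp ρA := by rw [LinearMap.rTensor_comp]

end HomLemmas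

section HomYD

variable {k H}
variable (Sinv : H →ₗ[k] H)

/-- The `k`-module of morphisms of Yetter-Drinfeld modules `Hom_H^H(A, B)`, as a
submodule of the `k`-linear maps. -/
def homYD (A B : YDCat k H Sinv) : Submodule k (A.M →ₗ[k] B.M) where
  carrier := {f | IsHom k H A.ρ B.ρ f}
  add_mem' := by
    rintro f g ⟨hf1, hf2⟩ ⟨hg1, hg2⟩
    refine ⟨fun h a => by simp [hf1, hg1, smul_add], ?_⟩
    rw [LinearMap.comp_add, LinearMap.rTensor_add, LinearMap.add_comp, hf2, hg2]
  zero_mem' := by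
    refine ⟨fun h a => by simp, ?_⟩
    rw [LinearMap.comp_zero, LinearMap.rTensor_zero, LinearMap.zero_comp]
  smul_mem' := by
    rintro c f ⟨hf1, hf2⟩
    refine ⟨fun h a => by
      rw [LinearMap.smul_apply, LinearMap.smul_apply, hf1, smul_comm], ?_⟩
    rw [LinearMap.comp_smul, LinearMap.rTensor_smul, LinearMap.smul_comp, hf2]

/-- Post-composition with a morphism of Yetter-Drinfeld modules, as a `k`-linear map
between morphism spaces. -/
def postcompYD {X B C : YDCat k H Sinv}
    (g : B.M →ₗ[k] C.M) (hg : IsHom k H B.ρ C.ρ g) :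
    ↥(homYD Sinv X B) →ₗ[k] ↥(homYD Sinv X C) where
  toFun f := ⟨g.comp f.1, IsHom.comp' f.2 hg⟩
  map_add' f g' := by ext x; simp
  map_smul' c f := by ext x; simp

/-- An injective resolution `0 → X → I⁰ → I¹ → ⋯` in the category of
Yetter-Drinfeld modules. -/
structure IsInjRes (X : YDCat k H Sinv) (I : ℕ → YDCat k H Sinv)
    (ε : X.M →ₗ[k] (I 0).M) (d : ∀ n, (I n).M →ₗ[k] (I (n + 1)).M) : Prop where
  eps_hom : IsHom k H X.ρ (I 0).ρ ε
  d_hom : ∀ n, IsHom k H (I n).ρ (I (n + 1)).ρ (d n)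
  inj : ∀ n, IsInjectiveYD k H Sinv (I n)
  mono : Function.Injective ε
  exact0 : LinearMap.range ε = LinearMap.ker (d 0)
  exact : ∀ n, LinearMap.range (d n) = LinearMap.ker (d (n + 1))

/-- A projective resolution `⋯ → P₁ → P₀ → X → 0` in the category of
Yetter-Drinfeld modules. -/
structure IsProjRes (X : YDCat k H Sinv) (P : ℕ → YDCat k H Sinv)
    (ε : (P 0).M →ₗ[k] X.M) (d : ∀ n, (P (n + 1)).M →ₗ[k] (P n).M) : Prop where
  eps_hom : IsHom k H (P 0).ρ X.ρ ε
  d_hom : ∀ n, IsHom k H (P (n + 1)).ρ (P n).ρ (d n)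
  proj : ∀ n, IsProjectiveYD k H Sinv (P n)
  epi : Function.Surjective ε
  exact0 : LinearMap.range (d 0) = LinearMap.ker ε
  exact : ∀ n, LinearMap.range (d (n + 1)) = LinearMap.ker (d n)

/-- The projective dimension of `X` in the category of Yetter-Drinfeld modules is
at most `n`. -/
def pdimLE (X : YDCat k H Sinv) (n : ℕ) : Prop :=
  ∃ (P : ℕ → YDCat k H Sinv) (ε : (P 0).M →ₗ[k] X.M)
    (d : ∀ m, (P (m + 1)).M →ₗ[k] (P m).M),
    IsProjRes Sinv X P ε d ∧ ∀ i, n < i → Subsingleton (P i).M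

/-- The injective dimension of `X` in the category of Yetter-Drinfeld modules is
at most `n`. -/
def injdimLE (X : YDCat k H Sinv) (n : ℕ) : Prop :=
  ∃ (I : ℕ → YDCat k H Sinv) (ε : X.M →ₗ[k] (I 0).M)
    (d : ∀ m, (I m).M →ₗ[k] (I (m + 1)).M),
    IsInjRes Sinv X I ε d ∧ ∀ i, n < i → Subsingleton (I i).M

/-- The complex `Hom(X, I⁰) → Hom(X, I¹) → ⋯` of morphism spaces induced by a
cochain of Yetter-Drinfeld modules. -/
def homCx (X : YDCat k H Sinv) (I : ℕ → YDCat k H Sinv)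
    (d : ∀ n, (I n).M →ₗ[k] (I (n + 1)).M)
    (hd : ∀ n, IsHom k H (I n).ρ (I (n + 1)).ρ (d n)) (n : ℕ) :
    ↥(homYD Sinv X (I n)) →ₗ[k] ↥(homYD Sinv X (I (n + 1))) :=
  postcompYD Sinv (d n) (hd n)

/-- Coboundaries of the induced complex. -/
def boundaries (X : YDCat k H Sinv) (I : ℕ → YDCat k H Sinv)
    (d : ∀ n, (I n).M →ₗ[k] (I (n + 1)).M)
    (hd : ∀ n, IsHom k H (I n).ρ (I (n + 1)).ρ (d n)) :
    ∀ i, Submodule k ↥(homYD Sinv X (I i))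
  | 0 => ⊥
  | (i + 1) => LinearMap.range (homCx Sinv X I d hd i)

/-- The `i`-th cohomology (cocycles modulo coboundaries) of the complex
`Hom(X, I⁰) → Hom(X, I¹) → ⋯`; when `I` is an injective resolution of `Y`, this is
`Ext^i(X, Y)`, the `i`-th right derived functor of `Hom_H^H(X, -)`, in the category
of Yetter-Drinfeld modules. -/
abbrev cohomology (X : YDCat k H Sinv) (I : ℕ → YDCat k H Sinv)
    (d : ∀ n, (I n).M →ₗ[k] (I (n + 1)).M)
    (hd : ∀ n, IsHom k H (I n).ρ (I (n + 1)).ρ (d n)) (i : ℕ) : Type :=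
  ↥(Submodule.map (boundaries Sinv X I d hd i).mkQ
      (LinearMap.ker (homCx Sinv X I d hd i)))

end HomYD

section CharProps

variable {k H}
variable (Sinv : H →ₗ[k] H)

/-- Characterizing property of the coaction on `Hom_H(A, B)` for Yetter-Drinfeld
modules `A`, `B`: it is determined by `f₀(m) ⊗ f₁ = f(m₀)₀ ⊗ f(m₀)₁ S(m₁)`. -/
def HomCoactChar (A B : YDCat k H Sinv)
    (ρQ : (A.M →ₗ[H] B.M) →ₗ[k] (A.M →ₗ[H] B.M) ⊗[k] H) : Prop :=
  ∀ (f : A.M →ₗ[H] B.M) (m : A.M) (t : Finset ℕ) (m₀ : ℕ → A.M) (m₁ : ℕ → H),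
    (∑ j ∈ t, m₀ j ⊗ₜ[k] m₁ j) = A.ρ m →
    (LinearMap.rTensor H (evalAtH (N := B.M) m)) (ρQ f) =
      ∑ j ∈ t, (LinearMap.lTensor B.M
          (LinearMap.mulRight k (HopfAlgebra.antipode (R := k) (A := H) (m₁ j))))
        (B.ρ (f (m₀ j)))

/-- Characterizing property of the coaction on `Hom_k(V, B)` for a comodule `V` and
a Yetter-Drinfeld module `B`: `g₀(v) ⊗ g₁ = g(v₀)₀ ⊗ g(v₀)₁ S(v₁)`. -/
def HomKCoactChar (V : ComodCat k H) (B : YDCat k H Sinv)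
    (ρ' : (V.V →ₗ[k] B.M) →ₗ[k] (V.V →ₗ[k] B.M) ⊗[k] H) : Prop :=
  ∀ (g : V.V →ₗ[k] B.M) (v : V.V) (t : Finset ℕ) (v₀ : ℕ → V.V) (v₁ : ℕ → H),
    (∑ j ∈ t, v₀ j ⊗ₜ[k] v₁ j) = V.ρ v →
    (LinearMap.rTensor H (evalAtK (N := B.M) v)) (ρ' g) =
      ∑ j ∈ t, (LinearMap.lTensor B.M
          (LinearMap.mulRight k (HopfAlgebra.antipode (R := k) (A := H) (v₁ j))))
        (B.ρ (g (v₀ j)))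

/-- Characterizing property of the Yetter-Drinfeld coaction on `H ⊗ V`:
`ρ(h ⊗ v) = h₂ ⊗ v₀ ⊗ h₃ v₁ S⁻¹(h₁)`. -/
def HTensorYDChar (V : ComodCat k H)
    (ρT : (H ⊗[k] V.V) →ₗ[k] (H ⊗[k] V.V) ⊗[k] H) : Prop :=
  ∀ (h : H) (v : V.V) (s t : Finset ℕ) (a b c : ℕ → H) (v₀ : ℕ → V.V) (v₁ : ℕ → H),
    (∑ i ∈ s, (a i ⊗ₜ[k] b i) ⊗ₜ[k] c i) = Delta2 k H h →
    (∑ j ∈ t, v₀ j ⊗ₜ[k] v₁ j) = V.ρ v →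
    ρT (h ⊗ₜ[k] v) =
      ∑ i ∈ s, ∑ j ∈ t, (b i ⊗ₜ[k] v₀ j) ⊗ₜ[k] (c i * v₁ j * Sinv (a i))

/-- Characterizing property of the Long dimodule coaction on `H ⊗ V`:
`ρ(h ⊗ v) = h ⊗ v₀ ⊗ v₁`. -/
def HTensorLongChar (V : ComodCat k H)
    (ρT : (H ⊗[k] V.V) →ₗ[k] (H ⊗[k] V.V) ⊗[k] H) : Prop :=
  ∀ (h : H) (v : V.V) (t : Finset ℕ) (v₀ : ℕ → V.V) (v₁ : ℕ → H),
    (∑ j ∈ t, v₀ j ⊗ₜ[k] v₁ j) = V.ρ v →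
    ρT (h ⊗ₜ[k] v) = ∑ j ∈ t, (h ⊗ₜ[k] v₀ j) ⊗ₜ[k] v₁ j

end CharProps

end RingPart

section CommPart

variable {k H : Type} [CommRing k] [CommRing H] [HopfAlgebra k H] (Sinv : H →ₗ[k] H)

/-- Characterizing property of the Yetter-Drinfeld coaction on `M ⊗_H N`:
`ρ(m ⊗ n) = m₀ ⊗ n₀ ⊗ n₁ m₁` (for `H` commutative). -/
def TensorCoactChar (A B : YDCat k H Sinv)
    (ρT : (A.M ⊗[H] B.M) →ₗ[k] (A.M ⊗[H] B.M) ⊗[k] H) : Prop :=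
  ∀ (m : A.M) (n : B.M) (s t : Finset ℕ) (m₀ : ℕ → A.M) (m₁ : ℕ → H)
    (n₀ : ℕ → B.M) (n₁ : ℕ → H),
    (∑ i ∈ s, m₀ i ⊗ₜ[k] m₁ i) = A.ρ m →
    (∑ j ∈ t, n₀ j ⊗ₜ[k] n₁ j) = B.ρ n →
    ρT (m ⊗ₜ[H] n) =
      ∑ i ∈ s, ∑ j ∈ t, (m₀ i ⊗ₜ[H] n₀ j) ⊗ₜ[k] (n₁ j * m₁ i)

/-- Restriction along `v ↦ 1 ⊗ v`, i.e. the canonical map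
`Hom_H(H ⊗ V, N) → Hom_k(V, N)`, `f ↦ (v ↦ f(1 ⊗ v))`. -/
def resUnitMap (V : Type) [AddCommGroup V] [Module k V] (N : Type) [AddCommGroup N]
    [Module k N] [Module H N] [IsScalarTower k H N] [SMulCommClass H k N] :
    ((H ⊗[k] V) →ₗ[H] N) →ₗ[k] (V →ₗ[k] N) where
  toFun f := (f.restrictScalars k).comp ((TensorProduct.mk k H V) 1)
  map_add' f g := by ext v; rfl
  map_smul' c f := by ext v; rfl

end CommPart

section Helpers

set_option linter.unusedSectionVars false

open WithConv HopfAlgebra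

lemma exists_sum_rep {Z ι : Type*} [AddCommMonoid Z] [Nonempty ι] (t : ι → Z) (z : Z)
    (hz : z ∈ AddSubmonoid.closure (Set.range t)) :
    ∃ (s : Finset ℕ) (g : ℕ → ι), ∑ i ∈ s, t (g i) = z := by
  suffices h : ∃ (n : ℕ) (g : ℕ → ι), ∑ i ∈ Finset.range n, t (g i) = z by
    obtain ⟨n, g, h⟩ := h
    exact ⟨_, g, h⟩
  induction hz using AddSubmonoid.closure_induction with
  | mem x hx =>
    obtain ⟨i, rfl⟩ := hx
    exact ⟨1, fun _ => i, by simp⟩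
  | zero => exact ⟨0, fun _ => Classical.arbitrary ι, by simp⟩
  | add x y _ _ hx hy =>
    obtain ⟨n, g, rfl⟩ := hx
    obtain ⟨m, g', rfl⟩ := hy
    refine ⟨n + m, fun i => if i < n then g i else g' (i - n), ?_⟩
    rw [Finset.sum_range_add]
    congr 1
    · refine Finset.sum_congr rfl fun i hi => ?_
      simp [Finset.mem_range.1 hi]
    · simp

variable {k : Type} [CommRing k]

lemma exists_rep2 {A B : Type} [AddCommGroup A] [Module k A] [AddCommGroup B] [Module k B]
    (z : A ⊗[k] B) :
    ∃ (s : Finset ℕ) (a : ℕ → A) (b : ℕ → B), ∑ i ∈ s, a i ⊗ₜ[k] b i = z := by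
  obtain ⟨s, g, h⟩ := exists_sum_rep (fun p : A × B => p.1 ⊗ₜ[k] p.2) z (by
    induction z with
    | zero => exact zero_mem _
    | tmul x y => exact AddSubmonoid.subset_closure ⟨(x, y), rfl⟩
    | add x y hx hy => exact add_mem hx hy)
  exact ⟨s, fun i => (g i).1, fun i => (g i).2, h⟩

lemma exists_rep3 {A B C : Type} [AddCommGroup A] [Module k A] [AddCommGroup B] [Module k B]
    [AddCommGroup C] [Module k C] (z : (A ⊗[k] B) ⊗[k] C) :
    ∃ (s : Finset ℕ) (a : ℕ → A) (b : ℕ → B) (c : ℕ → C),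
      ∑ i ∈ s, (a i ⊗ₜ[k] b i) ⊗ₜ[k] c i = z := by
  obtain ⟨s, g, h⟩ := exists_sum_rep
    (fun p : A × B × C => (p.1 ⊗ₜ[k] p.2.1) ⊗ₜ[k] p.2.2) z (by
    induction z with
    | zero => exact zero_mem _
    | tmul x y =>
      induction x with
      | zero => rw [TensorProduct.zero_tmul]; exact zero_mem _
      | tmul x x' => exact AddSubmonoid.subset_closure ⟨(x, x', y), rfl⟩
      | add x x' hx hx' => rw [TensorProduct.add_tmul]; exact add_mem hx hx'
    | add x y hx hy => exact add_mem hx hy)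
  exact ⟨s, fun i => (g i).1, fun i => (g i).2.1, fun i => (g i).2.2, h⟩

variable {H : Type} [CommRing H] [HopfAlgebra k H]

variable (k H) in
/-- left inclusion as a point of the group scheme -/
def ptX : WithConv (H →ₐ[k] H ⊗[k] H) := toConv Algebra.TensorProduct.includeLeft

variable (k H) in
/-- right inclusion as a point of the group scheme -/
def ptY : WithConv (H →ₐ[k] H ⊗[k] H) := toConv Algebra.TensorProduct.includeRight

variable (k H) in
/-- `h ↦ h₂ ⊗ h₃ S(h₁)` -/
def phi : H →ₐ[k] H ⊗[k] H := ((ptY k H)⁻¹ * ptX k H * ptY k H).ofConv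

variable (k H) in
/-- `a ⊗ b ↦ phi a * (1 ⊗ S b)` -/
def bigPhi : H ⊗[k] H →ₐ[k] H ⊗[k] H :=
  Algebra.TensorProduct.lift (phi k H) ((ptY k H)⁻¹).ofConv (fun _ _ => Commute.all _ _)

lemma ofConv_inv_eq {A : Type} [CommRing A] [Bialgebra k A] (f : WithConv (H →ₐ[k] A)) :
    (f⁻¹).ofConv = f.ofConv.comp (antipodeAlgHom k H) := rfl

lemma comp_inv {A B : Type} [CommRing A] [Bialgebra k A] [CommRing B] [Bialgebra k B]
    (h : A →ₐ[k] B) (f : WithConv (H →ₐ[k] A)) :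
    toConv (h.comp (f⁻¹).ofConv) = (toConv (h.comp f.ofConv))⁻¹ := rfl

lemma comp_mul' {A B : Type} [CommRing A] [Bialgebra k A] [CommRing B] [Bialgebra k B]
    (h : A →ₐ[k] B) (f g : WithConv (H →ₐ[k] A)) :
    toConv (h.comp (f * g).ofConv) = toConv (h.comp f.ofConv) * toConv (h.comp g.ofConv) := by
  rw [AlgHom.comp_convMul_distrib]

lemma bigPhi_phi (h : H) : bigPhi k H (phi k H h) = h ⊗ₜ[k] 1 := by
  have hx : toConv ((bigPhi k H).comp (ptX k H).ofConv) =
      (ptY k H)⁻¹ * ptX k H * ptY k H := by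
    apply WithConv.ofConv_injective
    ext a
    simp [bigPhi, ptX, phi]
  have hy : toConv ((bigPhi k H).comp (ptY k H).ofConv) = (ptY k H)⁻¹ := by
    apply WithConv.ofConv_injective
    ext a
    simp [bigPhi, ptY]
  have key : toConv ((bigPhi k H).comp (phi k H)) = ptX k H := by
    rw [phi, comp_mul', comp_mul', comp_inv, hx, hy]
    rw [inv_inv]
    have e1 : ptY k H * ((ptY k H)⁻¹ * ptX k H * ptY k H) = ptX k H * ptY k H := by
      rw [mul_assoc]; exact mul_inv_cancel_left (ptY k H) (ptX k H * ptY k H)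
    rw [e1]
    exact mul_inv_cancel_right (ptX k H) (ptY k H)
  exact DFunLike.congr_fun (congrArg WithConv.ofConv key) h

lemma antipode_antipode' (h : H) : antipode k (antipode k h) = h := by
  have := inv_inv (toConv (AlgHom.id k H) : WithConv (H →ₐ[k] H))
  exact DFunLike.congr_fun (congrArg WithConv.ofConv this) h

lemma ptX_mul_ptY : ptX k H * ptY k H = toConv (Bialgebra.comulAlgHom k H) := by
  apply WithConv.ofConv_injective
  rw [AlgHom.convMul_def]
  change ((Algebra.TensorProduct.lmul' k).comp (Algebra.TensorProduct.map _ _)).comp _ = _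
  have : (Algebra.TensorProduct.lmul' k).comp (Algebra.TensorProduct.map
      (ptX k H).ofConv (ptY k H).ofConv) = AlgHom.id k _ := by
    ext a <;> simp [ptX, ptY]
  rw [this]; rfl

lemma comul_antipode' (h : H) : Coalgebra.comul (R := k) (antipode k h) =
    (TensorProduct.map (antipode k) (antipode k))
      (TensorProduct.comm k H H (Coalgebra.comul (R := k) h)) := by
  have h1 : (toConv (Bialgebra.comulAlgHom k H))⁻¹ = (ptY k H)⁻¹ * (ptX k H)⁻¹ := by
    rw [← ptX_mul_ptY]; exact mul_inv_rev (ptX k H) (ptY k H)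
  have h2 := DFunLike.congr_fun (congrArg WithConv.ofConv h1) h
  rw [AlgHom.convMul_def] at h2
  refine h2.trans ?_
  change (Algebra.TensorProduct.lmul' k) (Algebra.TensorProduct.map _ _ (Coalgebra.comul h)) = _
  generalize (Coalgebra.comul (R := k) h) = z
  induction z with
  | zero => simp
  | tmul a b => simp [ofConv_inv_eq, ptX, ptY]
  | add x y hx hy => simp only [map_add, hx, hy]

lemma phi_rep (h : H) (s : Finset ℕ) (a b c : ℕ → H)
    (hs : (∑ i ∈ s, (a i ⊗ₜ[k] b i) ⊗ₜ[k] c i) = Delta2 k H h) :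
    phi k H h = ∑ i ∈ s, b i ⊗ₜ[k] (c i * antipode k (a i)) := by
  let L : (H ⊗[k] H) ⊗[k] H →ₐ[k] H ⊗[k] H :=
    (Algebra.TensorProduct.lmul' k).comp (Algebra.TensorProduct.map
      ((Algebra.TensorProduct.lmul' k).comp (Algebra.TensorProduct.map
        ((ptY k H)⁻¹).ofConv (ptX k H).ofConv)) (ptY k H).ofConv)
  have h1 : phi k H h = L (Delta2 k H h) := by
    change (Algebra.TensorProduct.lmul' k) (Algebra.TensorProduct.map _ _ (Coalgebra.comul h)) = _
    simp only [Delta2, LinearMap.comp_apply, L, AlgHom.comp_apply]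
    generalize (Coalgebra.comul (R := k) h) = z
    induction z with
    | zero => simp
    | tmul a b => rfl
    | add x y hx hy => simp only [map_add, hx, hy]
  rw [h1, ← hs, map_sum]
  refine Finset.sum_congr rfl fun i _ => ?_
  simp [L, ofConv_inv_eq, ptX, ptY, mul_comm]

/-- action of `H ⊗ H` on `N ⊗ H` -/
def actT (k H N : Type) [CommRing k] [CommRing H] [HopfAlgebra k H]
    [AddCommGroup N] [Module k N] [Module H N] [IsScalarTower k H N] [SMulCommClass H k N] :
    H ⊗[k] H →ₐ[k] Module.End k (N ⊗[k] H) :=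
  (Module.endTensorEndAlgHom (R := k) (S := k) (A := k) (M := N) (N := H)).comp
    (Algebra.TensorProduct.map (Algebra.lsmul k k N) (Algebra.lmul k H))

section Mods

variable {M N : Type} [AddCommGroup M] [Module k M] [Module H M]
  [IsScalarTower k H M] [SMulCommClass H k M]
  [AddCommGroup N] [Module k N] [Module H N] [IsScalarTower k H N] [SMulCommClass H k N]

@[simp] lemma actT_tmul (a b c : H) (n : N) :
    actT k H N (a ⊗ₜ b) (n ⊗ₜ c) = (a • n) ⊗ₜ (b * c) := by
  simp only [actT, AlgHom.comp_apply, Algebra.TensorProduct.map_tmul]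
  exact (LinearMap.congr_fun (Module.endTensorEndAlgHom_apply _ _) _)

lemma actT_left (a : H) (x : N ⊗[k] H) :
    actT k H N (a ⊗ₜ 1) x = LinearMap.rTensor H (smulMap k H a) x := by
  induction x with
  | zero => simp
  | tmul n c => simp [smulMap]
  | add x y hx hy => simp only [map_add, hx, hy]

lemma actT_right (b : H) (x : N ⊗[k] H) :
    actT k H N (1 ⊗ₜ b) x = LinearMap.lTensor N (LinearMap.mulRight k b) x := by
  induction x with
  | zero => simp
  | tmul n c => simp [mul_comm]
  | add x y hx hy => simp only [map_add, hx, hy]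

lemma rho_smul {Sinv : H →ₗ[k] H} (hS : ∀ h, Sinv h = antipode k h)
    {ρ : M →ₗ[k] M ⊗[k] H} (hρ : IsYDCompat k H Sinv ρ) (h : H) (m : M) :
    ρ (h • m) = actT k H M (phi k H h) (ρ m) := by
  obtain ⟨s, a, b, c, hs⟩ := exists_rep3 (Delta2 k H h)
  obtain ⟨t, m₀, m₁, ht⟩ := exists_rep2 (ρ m)
  rw [hρ h m s t a b c m₀ m₁ hs ht, phi_rep h s a b c hs, ← ht]
  simp only [map_sum, LinearMap.sum_apply, actT_tmul, hS]
  rw [Finset.sum_comm]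
  refine Finset.sum_congr rfl fun i _ => Finset.sum_congr rfl fun j _ => ?_
  rw [mul_right_comm]

variable (M) in
/-- `n ⊗ b ↦ (f ↦ f(n)₀ ⊗ f(n)₁ S(b))` -/
def bigD (ρN : N →ₗ[k] N ⊗[k] H) :
    M ⊗[k] H →ₗ[k] (M →ₗ[H] N) →ₗ[k] N ⊗[k] H :=
  TensorProduct.lift (LinearMap.mk₂ k
    (fun (n : M) (b : H) => (LinearMap.lTensor N (LinearMap.mulRight k (antipode k b))).comp
      (ρN.comp (evalAtH (N := N) n)))
    (by intro m m' b; ext f; simp [evalAtH])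
    (by intro c m b; ext f
        simp only [evalAtH, LinearMap.comp_apply, LinearMap.smul_apply, LinearMap.coe_mk, AddHom.coe_mk]
        rw [← IsScalarTower.algebraMap_smul H c m, map_smul, IsScalarTower.algebraMap_smul, map_smul, map_smul])
    (by intro m b b'; ext f
        simp only [map_add, LinearMap.comp_apply, LinearMap.add_apply]
        rw [← LinearMap.add_apply, ← LinearMap.lTensor_add]; congr 2; ext x; simp [mul_add])
    (by intro c m b; ext f
        simp only [map_smul, LinearMap.comp_apply, LinearMap.smul_apply]
        rw [← LinearMap.smul_apply, ← LinearMap.smul_apply, ← LinearMap.lTensor_smul]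
        congr 2; ext x; simp))

@[simp] lemma bigD_tmul (ρN : N →ₗ[k] N ⊗[k] H) (n : M) (b : H) (f : M →ₗ[H] N) :
    bigD M ρN (n ⊗ₜ b) f = LinearMap.lTensor N (LinearMap.mulRight k (antipode k b)) (ρN (f n)) := rfl

lemma bigD_act {Sinv : H →ₗ[k] H} (hS : ∀ h, Sinv h = antipode k h)
    {ρN : N →ₗ[k] N ⊗[k] H} (hρ : IsYDCompat k H Sinv ρN) (f : M →ₗ[H] N)
    (z : H ⊗[k] H) (y : M ⊗[k] H) :
    bigD M ρN (actT k H M z y) f = actT k H N (bigPhi k H z) (bigD M ρN y f) := by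
  induction y with
  | zero => simp
  | add x y hx hy => simp only [map_add, hx, hy, LinearMap.add_apply]
  | tmul n c =>
    induction z with
    | zero => simp
    | add x y hx hy => simp only [map_add, hx, hy, LinearMap.add_apply]
    | tmul a b =>
      have e : bigPhi k H (a ⊗ₜ b) = phi k H a * (1 ⊗ₜ antipode k b) := by
        simp [bigPhi, ofConv_inv_eq, ptY]
      rw [actT_tmul, bigD_tmul, bigD_tmul, map_smul, rho_smul hS hρ, ← actT_right, ← actT_right,
        ← Module.End.mul_apply, ← Module.End.mul_apply, ← map_mul, ← map_mul, e,
        antipode_mul_distrib]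
      congr 2
      rw [mul_assoc, Algebra.TensorProduct.tmul_mul_tmul, mul_one, mul_comm]

lemma bigD_smul {Sinv : H →ₗ[k] H} (hS : ∀ h, Sinv h = antipode k h)
    {ρM : M →ₗ[k] M ⊗[k] H} (hM : IsYDCompat k H Sinv ρM)
    {ρN : N →ₗ[k] N ⊗[k] H} (hρ : IsYDCompat k H Sinv ρN) (f : M →ₗ[H] N) (h : H) (m : M) :
    bigD M ρN (ρM (h • m)) f = LinearMap.rTensor H (smulMap k H h) (bigD M ρN (ρM m) f) := by
  rw [rho_smul hS hM, bigD_act hS hρ, bigPhi_phi, actT_left]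

/-- `n ↦ (m ↦ φ(m) n)` -/
def psi (φ : M →ₗ[H] H) : N →ₗ[k] (M →ₗ[H] N) where
  toFun n := φ.smulRight n
  map_add' _ _ := by ext; simp
  map_smul' c n := by
    ext m
    simp only [LinearMap.smulRight_apply, LinearMap.smul_apply, RingHom.id_apply]
    exact smul_comm _ _ _

lemma rTensor_eval_psi (Z : Type) [AddCommGroup Z] [Module k Z] (φ : M →ₗ[H] H) (m : M)
    (x : N ⊗[k] Z) :
    LinearMap.rTensor Z (evalAtH (k := k) (N := N) m) (LinearMap.rTensor Z (psi φ) x) =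
      LinearMap.rTensor Z (smulMap k H (φ m)) x := by
  rw [← LinearMap.comp_apply, ← LinearMap.rTensor_comp]; rfl

lemma eval_inj {ι : Type} [Fintype ι] (e : ι → M) (φ : ι → M →ₗ[H] H)
    (he : ∀ m, ∑ i, φ i m • e i = m) (Z : Type) [AddCommGroup Z] [Module k Z]
    (x y : (M →ₗ[H] N) ⊗[k] Z)
    (h : ∀ m, LinearMap.rTensor Z (evalAtH (k := k) (N := N) m) x =
      LinearMap.rTensor Z (evalAtH (k := k) (N := N) m) y) : x = y := by
  have key : ∀ x : (M →ₗ[H] N) ⊗[k] Z, ∑ i, LinearMap.rTensor Z (psi (φ i))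
      (LinearMap.rTensor Z (evalAtH (k := k) (N := N) (e i)) x) = x := by
    intro x
    induction x with
    | zero => simp
    | add x y hx hy => simp only [map_add, Finset.sum_add_distrib, hx, hy]
    | tmul f z =>
      simp only [LinearMap.rTensor_tmul]
      rw [← TensorProduct.sum_tmul]
      congr 1
      ext m
      conv_rhs => rw [← he m]
      simp [psi, evalAtH]
  rw [← key x, ← key y]
  simp only [h]

/-- `N ⊗ (H ⊗ H)` with `H ⊗ H` acting on the right -/
def actR (w : H ⊗[k] H) : N ⊗[k] (H ⊗[k] H) →ₗ[k] N ⊗[k] (H ⊗[k] H) :=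
  LinearMap.lTensor N (LinearMap.mulRight k w)

lemma actR_add (w w' : H ⊗[k] H) : actR (N := N) (w + w') = actR w + actR w' := by
  rw [actR, actR, actR, ← LinearMap.lTensor_add]; congr 1; ext <;> simp [mul_add]

lemma actR_smul (c : k) (w : H ⊗[k] H) : actR (N := N) (c • w) = c • actR w := by
  rw [actR, actR, ← LinearMap.lTensor_smul]; congr 1; ext <;> simp

/-- `n ⊗ w ↦ f(n)₀ ⊗ (f(n)₁ ⊗ f(n)₂) (S ⊗ S) τ(w)` -/
def bigF (ρN : N →ₗ[k] N ⊗[k] H) (f : M →ₗ[H] N) :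
    M ⊗[k] (H ⊗[k] H) →ₗ[k] N ⊗[k] (H ⊗[k] H) :=
  TensorProduct.lift (LinearMap.mk₂ k
    (fun (n : M) (w : H ⊗[k] H) =>
      actR (TensorProduct.map (antipode k) (antipode k) (TensorProduct.comm k H H w))
        (LinearMap.lTensor N (Coalgebra.comul (R := k) (A := H)) (ρN (f n))))
    (by intro m m' b; simp)
    (by intro c m b
        rw [← IsScalarTower.algebraMap_smul H c m, map_smul, IsScalarTower.algebraMap_smul, map_smul, map_smul, map_smul])
    (by intro m b b'; simp only [map_add, actR_add, LinearMap.add_apply])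
    (by intro c m b; simp only [map_smul, actR_smul, LinearMap.smul_apply]))

lemma bigF_tmul (ρN : N →ₗ[k] N ⊗[k] H) (f : M →ₗ[H] N) (n : M) (w : H ⊗[k] H) :
    bigF ρN f (n ⊗ₜ w) = 
      actR (TensorProduct.map (antipode k) (antipode k) (TensorProduct.comm k H H w))
        (LinearMap.lTensor N (Coalgebra.comul (R := k) (A := H)) (ρN (f n))) := rfl

lemma bigF_comul (ρN : N →ₗ[k] N ⊗[k] H) (f : M →ₗ[H] N) (y : M ⊗[k] H) :
    bigF ρN f (LinearMap.lTensor M (Coalgebra.comul (R := k) (A := H)) y) =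
      LinearMap.lTensor N (Coalgebra.comul (R := k) (A := H)) (bigD M ρN y f) := by
  induction y with
  | zero => simp
  | add x y hx hy => simp only [map_add, hx, hy, LinearMap.add_apply]
  | tmul n b =>
    rw [LinearMap.lTensor_tmul, bigF_tmul, ← comul_antipode', bigD_tmul]
    generalize ρN (f n) = x
    induction x with
    | zero => simp
    | add x y hx hy => simp only [map_add, hx, hy]
    | tmul n c => simp [actR]

lemma bigF_assoc {ρN : N →ₗ[k] N ⊗[k] H} (hN : IsComod k H ρN) (f : M →ₗ[H] N)
    (y : M ⊗[k] H) (c : H) :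
    bigF ρN f (TensorProduct.assoc k M H H (y ⊗ₜ c)) =
      TensorProduct.assoc k N H H (LinearMap.rTensor H
        ((LinearMap.lTensor N (LinearMap.mulRight k (antipode k c))).comp ρN)
        (bigD M ρN y f)) := by
  induction y with
  | zero => simp
  | add x y hx hy => simp only [map_add, hx, hy, LinearMap.add_apply, TensorProduct.add_tmul]
  | tmul n b =>
    rw [TensorProduct.assoc_tmul, bigF_tmul, ← hN.2, bigD_tmul]
    generalize ρN (f n) = x
    induction x with
    | zero => simp
    | add x y hx hy => simp only [map_add, hx, hy]
    | tmul n d =>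
      simp only [LinearMap.rTensor_tmul, LinearMap.lTensor_tmul, LinearMap.comp_apply]
      generalize ρN n = z
      induction z with
      | zero => simp
      | add x y hx hy => simp only [map_add, hx, hy, TensorProduct.add_tmul]
      | tmul n e => simp [actR]

/-- `n ⊗ b ↦ f(n)₀ ⊗ f(n)₁ b` -/
def bigE (ρN : N →ₗ[k] N ⊗[k] H) (f : M →ₗ[H] N) : M ⊗[k] H →ₗ[k] N ⊗[k] H :=
  TensorProduct.lift (LinearMap.mk₂ k
    (fun (n : M) (b : H) => LinearMap.lTensor N (LinearMap.mulRight k b) (ρN (f n)))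
    (by intro m m' b; simp)
    (by intro c m b
        rw [← IsScalarTower.algebraMap_smul H c m, map_smul, IsScalarTower.algebraMap_smul,
          map_smul, map_smul])
    (by intro m b b'
        rw [← LinearMap.add_apply, ← LinearMap.lTensor_add]; congr 2; ext x; simp [mul_add])
    (by intro c m b
        rw [← LinearMap.smul_apply, ← LinearMap.lTensor_smul]; congr 2; ext x; simp))

lemma bigE_tmul (ρN : N →ₗ[k] N ⊗[k] H) (f : M →ₗ[H] N) (n : M) (b : H) :
    bigE ρN f (n ⊗ₜ b) = LinearMap.lTensor N (LinearMap.mulRight k b) (ρN (f n)) := rfl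

lemma map_ksmul (f : M →ₗ[H] N) (c : k) (m : M) : f (c • m) = c • f m := by
  rw [← IsScalarTower.algebraMap_smul H c m, map_smul, IsScalarTower.algebraMap_smul]

lemma bigD_of_colin {ρM : M →ₗ[k] M ⊗[k] H} (hM : IsComod k H ρM)
    {ρN : N →ₗ[k] N ⊗[k] H} (f : M →ₗ[H] N)
    (hf : IsColin k H ρM ρN (f.restrictScalars k)) (m : M) :
    bigD M ρN (ρM m) f = f m ⊗ₜ 1 := by
  let W : M ⊗[k] (H ⊗[k] H) →ₗ[k] N ⊗[k] H := TensorProduct.map (f.restrictScalars k)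
    ((LinearMap.mul' k H).comp (LinearMap.lTensor H (antipode k)))
  have h1 : ∀ y : M ⊗[k] H, bigD M ρN y f =
      W (TensorProduct.assoc k M H H (LinearMap.rTensor H ρM y)) := by
    intro y
    induction y with
    | zero => simp
    | add x y hx hy => simp only [map_add, hx, hy, LinearMap.add_apply]
    | tmul n b =>
      have e : ρN (f n) = LinearMap.rTensor H (f.restrictScalars k) (ρM n) :=
        LinearMap.congr_fun hf n
      rw [bigD_tmul, e, LinearMap.rTensor_tmul]
      generalize ρM n = z
      induction z with
      | zero => simp
      | add x y hx hy => simp only [map_add, hx, hy, TensorProduct.add_tmul]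
      | tmul n e => simp [W]
  have h2 : ∀ y : M ⊗[k] H, W (LinearMap.lTensor M (Coalgebra.comul (R := k) (A := H)) y) =
      f (TensorProduct.rid k M (LinearMap.lTensor M (Coalgebra.counit (R := k) (A := H)) y))
        ⊗ₜ 1 := by
    intro y
    induction y with
    | zero => simp
    | add x y hx hy => simp only [map_add, hx, hy, TensorProduct.add_tmul]
    | tmul n b =>
      simp only [W, LinearMap.lTensor_tmul, TensorProduct.map_tmul, LinearMap.comp_apply,
        mul_antipode_lTensor_comul_apply, TensorProduct.rid_tmul, map_ksmul,
        LinearMap.restrictScalars_apply, Algebra.algebraMap_eq_smul_one, TensorProduct.tmul_smul,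
        TensorProduct.smul_tmul']
  rw [h1, hM.2, h2, hM.1]

lemma colin_of_bigD {ρM : M →ₗ[k] M ⊗[k] H} (hM : IsComod k H ρM)
    {ρN : N →ₗ[k] N ⊗[k] H} (f : M →ₗ[H] N)
    (hf : ∀ m, bigD M ρN (ρM m) f = f m ⊗ₜ 1) :
    IsColin k H ρM ρN (f.restrictScalars k) := by
  let V : M ⊗[k] (H ⊗[k] H) →ₗ[k] N ⊗[k] H := (bigE ρN f).comp (LinearMap.lTensor M
    ((LinearMap.mul' k H).comp (LinearMap.rTensor H (antipode k))))
  have h1 : ∀ (y : M ⊗[k] H) (c : H), V (TensorProduct.assoc k M H H (y ⊗ₜ c)) =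
      LinearMap.lTensor N (LinearMap.mulRight k c) (bigD M ρN y f) := by
    intro y c
    induction y with
    | zero => simp
    | add x y hx hy => simp only [map_add, hx, hy, LinearMap.add_apply, TensorProduct.add_tmul]
    | tmul n b =>
      simp only [V, TensorProduct.assoc_tmul, LinearMap.comp_apply, LinearMap.lTensor_tmul,
        LinearMap.rTensor_tmul, LinearMap.mul'_apply, bigE_tmul, bigD_tmul]
      rw [← LinearMap.lTensor_comp_apply]
      congr 2
      ext x
      simp [mul_assoc]
  have h2 : ∀ y : M ⊗[k] H, V (LinearMap.lTensor M (Coalgebra.comul (R := k) (A := H)) y) =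
      ρN (f (TensorProduct.rid k M
        (LinearMap.lTensor M (Coalgebra.counit (R := k) (A := H)) y))) := by
    intro y
    induction y with
    | zero => simp
    | add x y hx hy => simp only [map_add, hx, hy]
    | tmul n b =>
      simp only [V, LinearMap.lTensor_tmul, LinearMap.comp_apply,
        mul_antipode_rTensor_comul_apply, TensorProduct.rid_tmul, map_ksmul,
        Algebra.algebraMap_eq_smul_one, TensorProduct.tmul_smul, map_smul, bigE_tmul]
      congr 1
      have : LinearMap.mulRight k (1 : H) = LinearMap.id := by ext; simp
      rw [this]; simp
  have h3 : ∀ y : M ⊗[k] H, V (TensorProduct.assoc k M H H (LinearMap.rTensor H ρM y)) =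
      LinearMap.rTensor H (f.restrictScalars k) y := by
    intro y
    induction y with
    | zero => simp
    | add x y hx hy => simp only [map_add, hx, hy]
    | tmul n b =>
      rw [LinearMap.rTensor_tmul, h1, hf]
      simp
  ext m
  change ρN (f m) = LinearMap.rTensor H (f.restrictScalars k) (ρM m)
  rw [← h3, hM.2, h2, hM.1]

lemma bigD_counit {ρN : N →ₗ[k] N ⊗[k] H} (hN : IsComod k H ρN) (f : M →ₗ[H] N)
    (y : M ⊗[k] H) :
    TensorProduct.rid k N (LinearMap.lTensor N (Coalgebra.counit (R := k) (A := H))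
      (bigD M ρN y f)) =
    f (TensorProduct.rid k M (LinearMap.lTensor M (Coalgebra.counit (R := k) (A := H)) y)) := by
  induction y with
  | zero => simp
  | add x y hx hy => simp only [map_add, hx, hy, LinearMap.add_apply]
  | tmul n b =>
    rw [bigD_tmul, LinearMap.lTensor_tmul, TensorProduct.rid_tmul, map_ksmul]
    conv_rhs => rw [← hN.1 (f n)]
    generalize ρN (f n) = z
    induction z with
    | zero => simp
    | add x y hx hy => simp only [map_add, hx, hy, smul_add]
    | tmul n e => simp [smul_smul, mul_comm]

end Mods

end Helpers

/-- Lemma 1.2(2a). Let `H` be a commutative Hopf algebra with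
bijective antipode over a commutative ring `k`, faithfully flat over `k`, and let
`M`, `N` be Yetter-Drinfeld modules with `M` finitely generated projective as a left
`H`-module. Then `Hom_H(M, N)` is a right `H`-comodule with coaction determined by
`f₀(m) ⊗ f₁ = f(m₀)₀ ⊗ f(m₀)₁ S(m₁)`, and its coinvariants are exactly the
`H`-colinear maps: `Hom_H^H(M, N) = Hom_H(M, N)^{co H}`. -/
theorem homH_comodule_and_coinvariants
    (k H : Type) [CommRing k] [CommRing H] [HopfAlgebra k H]
    [Module.FaithfullyFlat k H]
    (Sinv : H →ₗ[k] H)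
    (hS1 : ∀ h : H, Sinv (HopfAlgebra.antipode (R := k) (A := H) h) = h)
    (hS2 : ∀ h : H, HopfAlgebra.antipode (R := k) (A := H) (Sinv h) = h)
    (M N : YDCat k H Sinv)
    (hMfin : Module.Finite H M.M) (hMproj : Module.Projective H M.M) :
    ∃ ρQ : (M.M →ₗ[H] N.M) →ₗ[k] (M.M →ₗ[H] N.M) ⊗[k] H,
      IsComod k H ρQ ∧ HomCoactChar Sinv M N ρQ ∧
      ∀ f : M.M →ₗ[H] N.M,
        f ∈ coinv ρQ ↔ IsColin k H M.ρ N.ρ (f.restrictScalars k) := by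
  have hS : ∀ h, Sinv h = HopfAlgebra.antipode k h := fun h => by
    conv_lhs => rw [← antipode_antipode' (k := k) h]
    exact hS1 _
  obtain ⟨n, p, s, -, -, hps⟩ := Module.Finite.exists_comp_eq_id_of_projective H M.M
  let e : Fin n → M.M := fun i => p (Pi.single i 1)
  let φ : Fin n → M.M →ₗ[H] H := fun i => (LinearMap.proj i).comp s
  have he : ∀ m, ∑ i, φ i m • e i = m := by
    intro m
    have h1 : p (s m) = m := LinearMap.congr_fun hps m
    conv_rhs => rw [← h1, pi_eq_sum_univ' (s m)]
    rw [map_sum]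
    refine Finset.sum_congr rfl fun i _ => ?_
    simp only [e, φ, LinearMap.comp_apply, LinearMap.proj_apply, ← map_smul]
  let ρQ : (M.M →ₗ[H] N.M) →ₗ[k] (M.M →ₗ[H] N.M) ⊗[k] H :=
    ∑ i, (LinearMap.rTensor H (psi (φ i))).comp (bigD M.M N.ρ (M.ρ (e i)))
  have hev : ∀ (f : M.M →ₗ[H] N.M) (m : M.M),
      LinearMap.rTensor H (evalAtH (k := k) (N := N.M) m) (ρQ f) = bigD M.M N.ρ (M.ρ m) f := by
    intro f m
    simp only [ρQ, LinearMap.sum_apply, map_sum, LinearMap.comp_apply, rTensor_eval_psi]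
    conv_rhs => rw [← he m, map_sum, map_sum, LinearMap.sum_apply]
    refine Finset.sum_congr rfl fun i _ => ?_
    rw [bigD_smul hS M.compat N.compat]
  have hev' : ∀ m : M.M, (LinearMap.rTensor H (evalAtH (k := k) (N := N.M) m)).comp ρQ =
      bigD M.M N.ρ (M.ρ m) := fun m => LinearMap.ext fun f => hev f m
  refine ⟨ρQ, ⟨?_, ?_⟩, ?_, ?_⟩
  · intro f
    ext m
    have h1 : ∀ x : (M.M →ₗ[H] N.M) ⊗[k] H,
        (TensorProduct.rid k _ (LinearMap.lTensor _ (Coalgebra.counit (R := k) (A := H)) x)) m =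
        TensorProduct.rid k _ (LinearMap.lTensor _ (Coalgebra.counit (R := k) (A := H))
          (LinearMap.rTensor H (evalAtH (k := k) (N := N.M) m) x)) := by
      intro x
      induction x with
      | zero => simp
      | add x y hx hy => simp only [map_add, hx, hy, LinearMap.add_apply]
      | tmul f b => simp [evalAtH]
    rw [h1, hev, bigD_counit N.comod, M.comod.1]
  · intro f
    refine eval_inj e φ he _ _ _ fun m => ?_
    have h1 : ∀ x : (M.M →ₗ[H] N.M) ⊗[k] H,
        LinearMap.rTensor (H ⊗[k] H) (evalAtH (k := k) (N := N.M) m)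
          (LinearMap.lTensor _ (Coalgebra.comul (R := k) (A := H)) x) =
        LinearMap.lTensor _ (Coalgebra.comul (R := k) (A := H))
          (LinearMap.rTensor H (evalAtH (k := k) (N := N.M) m) x) := by
      intro x
      induction x with
      | zero => simp
      | add x y hx hy => simp only [map_add, hx, hy]
      | tmul f b => simp
    have h2 : ∀ z : ((M.M →ₗ[H] N.M) ⊗[k] H) ⊗[k] H,
        LinearMap.rTensor (H ⊗[k] H) (evalAtH (k := k) (N := N.M) m)
          (TensorProduct.assoc k _ H H z) =
        TensorProduct.assoc k _ H H (LinearMap.rTensor H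
          (LinearMap.rTensor H (evalAtH (k := k) (N := N.M) m)) z) := by
      intro z
      induction z with
      | zero => simp
      | add x y hx hy => simp only [map_add, hx, hy]
      | tmul x b =>
        induction x with
        | zero => simp
        | add x y hx hy => simp only [map_add, hx, hy, TensorProduct.add_tmul]
        | tmul f c => simp
    rw [h1, hev, ← bigF_comul, ← M.comod.2, h2, ← LinearMap.rTensor_comp_apply, hev']
    generalize M.ρ m = y
    induction y with
    | zero => simp
    | add x y hx hy =>
      simp only [map_add, LinearMap.rTensor_add, LinearMap.add_apply, hx, hy]
    | tmul m c =>
      rw [LinearMap.rTensor_tmul, bigF_assoc N.comod, ← hev f m, ← LinearMap.rTensor_comp_apply]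
      rfl
  · intro f m t m₀ m₁ ht
    rw [hev, ← ht]
    simp only [map_sum, LinearMap.sum_apply, bigD_tmul]
  · intro f
    rw [mem_coinv]
    constructor
    · intro h
      refine colin_of_bigD M.comod f fun m => ?_
      rw [← hev, h]; rfl
    · intro h
      refine eval_inj e φ he _ _ _ fun m => ?_
      rw [hev, bigD_of_colin M.comod f h]; rfl
end YDPaper
end
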